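/- Let n ≥ 3, let α, β, γ, ν, μ be real numbers and 1 < q < ∞. Assume μ > 0 and that the parameters satisfy: (i) γ = α + β + n/2 − ν + μ/q; (ii) γ > 0; (iii) n/2 − 1 − qα < μ < q(γ − α) − n/2 + 1. Then the operator S = S_{α,β,γ} is bounded from L^1_ν(Λ_n) into L^q_μ(Λ_n). (This is the sufficiency lemma, Lemma 4.2 of the paper, instantiated on the rank-2 Lorentz cone, where n/r = n/2.) -/

import Mathlib

open MeasureTheory ENNReal

noncomputable section

/-- The Lorentz determinant `Δ(y) = y₁² − y₂² − ⋯ − y_n²`. -/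
def lDelta (n : ℕ) [NeZero n] (y : Fin n → ℝ) : ℝ :=
  2 * y 0 ^ 2 - ∑ i, y i ^ 2

/-- The Lorentz cone `Λ_n`. -/
def lCone (n : ℕ) [NeZero n] : Set (Fin n → ℝ) :=
  {y | 0 < lDelta n y ∧ 0 < y 0}

/-- The `L^p_ν(Λ_n)` norm `(∫_{Λ_n} |g(y)|^p Δ(y)^{ν−n/2} dy)^{1/p}`. -/
def coneNorm (n : ℕ) [NeZero n] (p ν : ℝ) (g : (Fin n → ℝ) → ℝ) : ℝ≥0∞ :=
  (∫⁻ y in lCone n, ENNReal.ofReal (|g y| ^ p * lDelta n y ^ (ν - (n : ℝ) / 2))) ^ (1 / p)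

/-- The operator `S_{α,β,γ}` applied to `|g|`:
`S|g|(y) = Δ(y)^α ∫_{Λ_n} Δ(y+x)^{−γ} |g(x)| Δ(x)^β dx`. -/
def Sop (n : ℕ) [NeZero n] (α β γ : ℝ) (g : (Fin n → ℝ) → ℝ) (y : Fin n → ℝ) : ℝ≥0∞ :=
  ENNReal.ofReal (lDelta n y ^ α) *
    ∫⁻ x in lCone n, ENNReal.ofReal (lDelta n (y + x) ^ (-γ) * |g x| * lDelta n x ^ β)

/-- The `L^q_μ(Λ_n)` norm of `S_{α,β,γ}|g|`. -/
def SopNorm (n : ℕ) [NeZero n] (α β γ q μ : ℝ) (g : (Fin n → ℝ) → ℝ) : ℝ≥0∞ :=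
  (∫⁻ y in lCone n, Sop n α β γ g y ^ q * ENNReal.ofReal (lDelta n y ^ (μ - (n : ℝ) / 2))) ^ (1 / q)

/-- `S_{α,β,γ}` is bounded from `L^p_ν(Λ_n)` to `L^q_μ(Λ_n)`:
`‖S|g|‖_{q,μ} ≤ C ‖g‖_{p,ν}` for every `g ∈ L^p_ν(Λ_n)`. -/
def SBounded (n : ℕ) [NeZero n] (α β γ p ν q μ : ℝ) : Prop :=
  ∃ C > (0 : ℝ), ∀ g : (Fin n → ℝ) → ℝ, Measurable g → coneNorm n p ν g < ⊤ →
    SopNorm n α β γ q μ g ≤ ENNReal.ofReal C * coneNorm n p ν g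

/-- Integration of a radial function in polar coordinates, for the lower Lebesgue integral. -/
theorem lintegral_fun_norm_eq {E : Type*} [NormedAddCommGroup E] [NormedSpace ℝ E]
    [MeasurableSpace E] [BorelSpace E] [FiniteDimensional ℝ E] [Nontrivial E]
    (μ : Measure E) [μ.IsAddHaarMeasure] (f : ℝ → ℝ≥0∞) (hf : Measurable f) :
    ∫⁻ x, f ‖x‖ ∂μ = μ.toSphere Set.univ *
      ∫⁻ r in Set.Ioi (0 : ℝ), ENNReal.ofReal (r ^ (Module.finrank ℝ E - 1)) * f r := by
  calc
    ∫⁻ x, f ‖x‖ ∂μ = ∫⁻ x : ({(0)}ᶜ : Set E), f ‖x.1‖ ∂(μ.comap (↑)) := by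
      rw [lintegral_subtype_comap (measurableSet_singleton _).compl fun x ↦ f ‖x‖,
        restrict_compl_singleton]
    _ = ∫⁻ x, f x.2 ∂μ.toSphere.prod (.volumeIoiPow (Module.finrank ℝ E - 1)) := by
      have hfs : Measurable fun x : Metric.sphere (0 : E) 1 × Set.Ioi (0 : ℝ) ↦ f x.2 := by fun_prop
      rw [← μ.measurePreserving_homeomorphUnitSphereProd.lintegral_comp hfs]
      simp
    _ = _ := by
      have hfs : Measurable fun x : Metric.sphere (0 : E) 1 × Set.Ioi (0 : ℝ) ↦ f x.2 := by fun_prop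
      rw [lintegral_prod _ hfs.aemeasurable]
      dsimp only
      rw [lintegral_const, mul_comm, Measure.volumeIoiPow,
        lintegral_withDensity_eq_lintegral_mul _ (by fun_prop)
          (g := fun r : Set.Ioi (0 : ℝ) ↦ f r) (by fun_prop)]
      congr 1
      exact lintegral_subtype_comap measurableSet_Ioi
        fun r ↦ ENNReal.ofReal (r ^ (Module.finrank ℝ E - 1)) * f r

theorem lintegral_rpow_mul_one_add_rpow_lt_top {c s : ℝ} (hc : -1 < c) (hs : c - s < -1) :
    ∫⁻ t in Set.Ioi (0 : ℝ), ENNReal.ofReal (t ^ c * (1 + t) ^ (-s)) < ⊤ := by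
  have hs0 : 0 < s := by linarith
  have h1 : ∫⁻ t in Set.Ioo (0 : ℝ) 1, ENNReal.ofReal (t ^ c) < ⊤ :=
    ((intervalIntegral.integrableOn_Ioo_rpow_iff one_pos).2 hc).lintegral_lt_top
  have h2 : ∫⁻ t in Set.Ioi (1 / 2 : ℝ), ENNReal.ofReal (t ^ (c - s)) < ⊤ :=
    (integrableOn_Ioi_rpow_of_lt hs (by norm_num)).lintegral_lt_top
  have hcov : Set.Ioi (0 : ℝ) ⊆ Set.Ioo (0 : ℝ) 1 ∪ Set.Ioi (1 / 2) := by
    intro t ht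
    simp only [Set.mem_Ioi, Set.mem_union, Set.mem_Ioo] at *
    by_cases h : t < 1
    · exact Or.inl ⟨ht, h⟩
    · right; linarith
  refine (lintegral_mono_set hcov (μ := volume)).trans_lt ((lintegral_union_le _ _ _).trans_lt ?_)
  refine ENNReal.add_lt_top.2 ⟨lt_of_le_of_lt ?_ h1, lt_of_le_of_lt ?_ h2⟩
  · refine setLIntegral_mono (by fun_prop) fun t ht ↦ ENNReal.ofReal_le_ofReal ?_
    refine mul_le_of_le_one_right (Real.rpow_nonneg ht.1.le _)
      (Real.rpow_le_one_of_one_le_of_nonpos (by linarith [ht.1]) (by linarith))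
  · refine setLIntegral_mono (by fun_prop) fun t ht ↦ ENNReal.ofReal_le_ofReal ?_
    have ht0 : (0 : ℝ) < t := lt_trans (by norm_num) ht
    rw [sub_eq_add_neg, Real.rpow_add ht0]
    exact mul_le_mul_of_nonneg_left
      (Real.rpow_le_rpow_of_nonpos ht0 (by linarith) (by linarith)) (Real.rpow_nonneg ht0.le _)

/-- Pointwise bound by a product of a function of `t` and a function of `t - r`. -/
theorem pow_mul_sq_sub_sq_rpow_le {c s t r : ℝ} {d : ℕ} (hs : 0 < s) (hr : 0 < r) (hrt : r < t) :
    r ^ d * ((t ^ 2 - r ^ 2) ^ c * ((1 + t) ^ 2 - r ^ 2) ^ (-s)) ≤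
      (1 + 2 ^ c) * (t ^ (c + d) * (1 + t) ^ (-s)) * ((t - r) ^ c * (1 + (t - r)) ^ (-s)) := by
  have ht : 0 < t := hr.trans hrt
  have hsub : 0 < t - r := sub_pos.2 hrt
  have e1 : (t ^ 2 - r ^ 2) ^ c = (t + r) ^ c * (t - r) ^ c := by
    rw [← Real.mul_rpow (by positivity) hsub.le]; congr 1; ring
  have e2 : ((1 + t) ^ 2 - r ^ 2) ^ (-s) = (1 + t + r) ^ (-s) * (1 + (t - r)) ^ (-s) := by
    rw [← Real.mul_rpow (by positivity) (by positivity)]; congr 1; ring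
  have b1 : (t + r) ^ c ≤ (1 + 2 ^ c) * t ^ c := by
    have htc : 0 < t ^ c := Real.rpow_pos_of_pos ht c
    have h2c : (0 : ℝ) < 2 ^ c := Real.rpow_pos_of_pos two_pos c
    rcases le_total 0 c with hc | hc
    · calc (t + r) ^ c ≤ (2 * t) ^ c := Real.rpow_le_rpow (by positivity) (by linarith) hc
        _ = 2 ^ c * t ^ c := Real.mul_rpow two_pos.le ht.le
        _ ≤ _ := by nlinarith
    · calc (t + r) ^ c ≤ t ^ c := Real.rpow_le_rpow_of_nonpos ht (by linarith) hc
        _ ≤ _ := by nlinarith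
  have b2 : (1 + t + r) ^ (-s) ≤ (1 + t) ^ (-s) :=
    Real.rpow_le_rpow_of_nonpos (by positivity) (by linarith) (by linarith)
  have b3 : r ^ d ≤ t ^ d := by gcongr
  rw [e1, e2, Real.rpow_add ht, Real.rpow_natCast]
  calc r ^ d * ((t + r) ^ c * (t - r) ^ c * ((1 + t + r) ^ (-s) * (1 + (t - r)) ^ (-s)))
      ≤ t ^ d * ((1 + 2 ^ c) * t ^ c * (t - r) ^ c *
          ((1 + t) ^ (-s) * (1 + (t - r)) ^ (-s))) := by gcongr
    _ = _ := by ring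

theorem lDelta_succ {m : ℕ} (y : Fin (m + 1) → ℝ) :
    lDelta (m + 1) y = y 0 ^ 2 - ∑ i : Fin m, y i.succ ^ 2 := by
  rw [lDelta, Fin.sum_univ_succ]; ring

theorem lDelta_succ_eq_norm {m : ℕ} (y : Fin (m + 1) → ℝ) :
    lDelta (m + 1) y = y 0 ^ 2 - ‖WithLp.toLp 2 (Fin.tail y)‖ ^ 2 := by
  rw [lDelta_succ, EuclideanSpace.norm_sq_eq]; simp [Fin.tail]

theorem mem_lCone_succ {m : ℕ} {y : Fin (m + 1) → ℝ} :
    y ∈ lCone (m + 1) ↔ ‖WithLp.toLp 2 (Fin.tail y)‖ < y 0 := by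
  rw [lCone, Set.mem_ofPred_eq, lDelta_succ_eq_norm, sub_pos]
  constructor
  · rintro ⟨h, h0⟩
    exact lt_of_pow_lt_pow_left₀ 2 h0.le h
  · intro h
    exact ⟨by gcongr, (norm_nonneg _).trans_lt h⟩

theorem measurable_lDelta (n : ℕ) [NeZero n] : Measurable (lDelta n) := by
  unfold lDelta; fun_prop

theorem measurableSet_lCone (n : ℕ) [NeZero n] : MeasurableSet (lCone n) :=
  (measurableSet_lt measurable_const (measurable_lDelta n)).inter
    (measurableSet_lt measurable_const (measurable_pi_apply 0))

/-- Integration of functions of `y₁` and `|(y₂, …, y_n)|`. -/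
theorem lintegral_head_norm_tail {m : ℕ} (F : ℝ × ℝ → ℝ≥0∞) (hF : Measurable F) :
    ∫⁻ y : Fin (m + 1) → ℝ, F (y 0, ‖WithLp.toLp 2 (Fin.tail y)‖) =
      ∫⁻ t : ℝ, ∫⁻ z : EuclideanSpace ℝ (Fin m), F (t, ‖z‖) := by
  have h1 := volume_preserving_piFinSuccAbove (fun _ : Fin (m + 1) ↦ ℝ) 0
  have h2 := ((MeasurePreserving.id (volume : Measure ℝ)).prod
    (PiLp.volume_preserving_toLp (Fin m))).comp h1
  have hG : Measurable fun p : ℝ × EuclideanSpace ℝ (Fin m) ↦ F (p.1, ‖p.2‖) := by fun_prop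
  rw [← lintegral_prod _ hG.aemeasurable, ← h2.lintegral_comp hG]
  rfl

theorem lintegral_lCone_vertex_lt_top {m : ℕ} (hm : 1 ≤ m) {c s : ℝ} (hc : -1 < c)
    (hs : c + m < s) :
    ∫⁻ y in lCone (m + 1), ENNReal.ofReal
      (lDelta (m + 1) y ^ c * lDelta (m + 1) (y + Pi.single 0 1) ^ (-s)) < ⊤ := by
  have hm' : (1 : ℝ) ≤ m := by exact_mod_cast hm
  have : Nonempty (Fin m) := ⟨⟨0, hm⟩⟩
  have hs0 : 0 < s := by linarith
  set F : ℝ × ℝ → ℝ≥0∞ := {p : ℝ × ℝ | p.2 < p.1}.indicator fun p ↦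
    ENNReal.ofReal ((p.1 ^ 2 - p.2 ^ 2) ^ c * ((1 + p.1) ^ 2 - p.2 ^ 2) ^ (-s)) with hFdef
  have hF : Measurable F :=
    Measurable.indicator (by fun_prop) (measurableSet_lt measurable_snd measurable_fst)
  set g : ℝ → ℝ → ℝ≥0∞ := fun a ↦ (Set.Ioi 0).indicator fun u ↦
    ENNReal.ofReal (u ^ a * (1 + u) ^ (-s)) with hg
  have hgm (a : ℝ) : Measurable (g a) := Measurable.indicator (by fun_prop) measurableSet_Ioi
  have hgpos (a : ℝ) {u : ℝ} (hu : 0 < u) : g a u = ENNReal.ofReal (u ^ a * (1 + u) ^ (-s)) :=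
    Set.indicator_of_mem hu _
  have hfin (a : ℝ) (h1 : -1 < a) (h2 : a - s < -1) : ∫⁻ u, g a u < ⊤ := by
    rw [hg, lintegral_indicator measurableSet_Ioi]
    exact lintegral_rpow_mul_one_add_rpow_lt_top h1 h2
  have hd : ((m - 1 : ℕ) : ℝ) = m - 1 := by push_cast [Nat.cast_sub hm]; ring
  set K : ℝ≥0∞ := (volume : Measure (EuclideanSpace ℝ (Fin m))).toSphere Set.univ
  have hK : K < ⊤ := measure_lt_top _ _
  calc ∫⁻ y in lCone (m + 1), ENNReal.ofReal
        (lDelta (m + 1) y ^ c * lDelta (m + 1) (y + Pi.single 0 1) ^ (-s))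
      = ∫⁻ y : Fin (m + 1) → ℝ, F (y 0, ‖WithLp.toLp 2 (Fin.tail y)‖) := by
        rw [← lintegral_indicator (measurableSet_lCone _)]
        refine lintegral_congr fun y ↦ ?_
        have htail : Fin.tail (y + Pi.single 0 1) = Fin.tail y := by
          ext i; simp [Fin.tail]
        by_cases hy : y ∈ lCone (m + 1)
        · have hy' := mem_lCone_succ.1 hy
          rw [Set.indicator_of_mem hy, hFdef, Set.indicator_of_mem (by exact hy'),
            lDelta_succ_eq_norm, lDelta_succ_eq_norm, htail]
          simp [add_comm]
        · have hy' := fun h ↦ hy (mem_lCone_succ.2 h)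
          rw [Set.indicator_of_notMem hy, hFdef, Set.indicator_of_notMem (by exact hy')]
    _ = ∫⁻ t : ℝ, ∫⁻ z : EuclideanSpace ℝ (Fin m), F (t, ‖z‖) := lintegral_head_norm_tail F hF
    _ = ∫⁻ t : ℝ, K * ∫⁻ r in Set.Ioi (0 : ℝ), ENNReal.ofReal (r ^ (m - 1)) * F (t, r) := by
        refine lintegral_congr fun t ↦ ?_
        rw [lintegral_fun_norm_eq volume (fun r ↦ F (t, r)) (by fun_prop),
          finrank_euclideanSpace_fin]
    _ ≤ ∫⁻ t : ℝ, K * ∫⁻ r : ℝ, ENNReal.ofReal (1 + 2 ^ c) * g (c + (m - 1)) t *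
          g c (t - r) := by
        refine lintegral_mono fun t ↦ ?_
        gcongr K * ?_
        rw [← lintegral_indicator measurableSet_Ioi]
        refine lintegral_mono fun r ↦ Set.indicator_apply_le' (fun hr ↦ ?_) fun _ ↦ zero_le
        by_cases hrt : r < t
        · rw [hFdef, Set.indicator_of_mem (by exact hrt)]
          have ht : 0 < t := lt_trans hr hrt
          rw [hgpos _ ht, hgpos _ (sub_pos.2 hrt), ← ENNReal.ofReal_mul (pow_nonneg (le_of_lt hr) _),
            ← ENNReal.ofReal_mul (by positivity), ← ENNReal.ofReal_mul (by positivity), ← hd]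
          exact ENNReal.ofReal_le_ofReal (pow_mul_sq_sub_sq_rpow_le hs0 hr hrt)
        · rw [hFdef, Set.indicator_of_notMem (by exact hrt), mul_zero]
          exact zero_le
    _ = K * (ENNReal.ofReal (1 + 2 ^ c) * (∫⁻ t, g (c + (m - 1)) t) * ∫⁻ u, g c u) := by
        have (t : ℝ) : ∫⁻ r : ℝ, ENNReal.ofReal (1 + 2 ^ c) * g (c + (m - 1)) t * g c (t - r) =
            ENNReal.ofReal (1 + 2 ^ c) * g (c + (m - 1)) t * ∫⁻ u, g c u := by
          rw [lintegral_const_mul _ (by fun_prop), lintegral_sub_left_eq_self (g c) t]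
        simp_rw [this]
        rw [lintegral_const_mul _ (by fun_prop), lintegral_mul_const _ (by fun_prop),
          lintegral_const_mul _ (by fun_prop)]
    _ < ⊤ := ENNReal.mul_lt_top hK (ENNReal.mul_lt_top (ENNReal.mul_lt_top ENNReal.ofReal_lt_top
        (hfin _ (by linarith) (by linarith))) (hfin _ hc (by linarith)))

/-- The bilinear form with quadratic form `lDelta`. -/
def lorentzForm (n : ℕ) [NeZero n] : LinearMap.BilinForm ℝ (Fin n → ℝ) :=
  LinearMap.mk₂ ℝ (fun x y ↦ 2 * (x 0 * y 0) - x ⬝ᵥ y)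
    (by intros; simp [add_dotProduct]; ring) (by intros; simp [smul_dotProduct]; ring)
    (by intros; simp [dotProduct_add]; ring) (by intros; simp [dotProduct_smul]; ring)

theorem lorentzForm_apply {n : ℕ} [NeZero n] (x y : Fin n → ℝ) :
    lorentzForm n x y = 2 * (x 0 * y 0) - x ⬝ᵥ y := rfl

theorem lorentzForm_self {n : ℕ} [NeZero n] (x : Fin n → ℝ) :
    lorentzForm n x x = lDelta n x := by
  simp [lorentzForm_apply, lDelta, dotProduct, pow_two]

theorem lorentzForm_comm {n : ℕ} [NeZero n] (x y : Fin n → ℝ) :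
    lorentzForm n x y = lorentzForm n y x := by
  rw [lorentzForm_apply, lorentzForm_apply, dotProduct_comm, mul_comm (x 0)]

theorem lorentzForm_single {n : ℕ} [NeZero n] (x : Fin n → ℝ) :
    lorentzForm n x (Pi.single 0 1) = x 0 := by
  simp [lorentzForm_apply]; ring

theorem lorentzForm_pos {n : ℕ} [NeZero n] {x y : Fin n → ℝ} (hx : x ∈ lCone n)
    (hy : y ∈ lCone n) : 0 < lorentzForm n x y := by
  obtain ⟨m, rfl⟩ : ∃ m, n = m + 1 := Nat.exists_eq_succ_of_ne_zero (NeZero.ne n)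
  have hx' := hx.1
  have hy' := hy.1
  rw [lDelta_succ, sub_pos] at hx' hy'
  have hcs := Finset.sum_mul_sq_le_sq_mul_sq Finset.univ (fun i : Fin m ↦ x i.succ)
    (fun i ↦ y i.succ)
  have hlt : (∑ i : Fin m, x i.succ * y i.succ) ^ 2 < (x 0 * y 0) ^ 2 := by
    rw [mul_pow]
    exact hcs.trans_lt (mul_lt_mul'' hx' hy' (by positivity) (by positivity))
  have := lt_of_pow_lt_pow_left₀ 2 (mul_pos hx.2 hy.2).le hlt
  rw [lorentzForm_apply, dotProduct, Fin.sum_univ_succ]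
  linarith

theorem lDelta_add_pos {n : ℕ} [NeZero n] {x y : Fin n → ℝ} (hx : x ∈ lCone n)
    (hy : y ∈ lCone n) : 0 < lDelta n (x + y) := by
  have h := lorentzForm_pos hx hy
  have h1 := hx.1
  have h2 := hy.1
  rw [← lorentzForm_self] at *
  simp only [map_add, LinearMap.add_apply, lorentzForm_comm y x]
  linarith

theorem single_mem_lCone (n : ℕ) [NeZero n] : Pi.single 0 1 ∈ lCone n := by
  constructor <;> simp [← lorentzForm_self, lorentzForm_single]

theorem lDelta_smul {n : ℕ} [NeZero n] (t : ℝ) (x : Fin n → ℝ) :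
    lDelta n (t • x) = t ^ 2 * lDelta n x := by
  simp [← lorentzForm_self]; ring

theorem smul_mem_lCone {n : ℕ} [NeZero n] {t : ℝ} (ht : 0 < t) {x : Fin n → ℝ}
    (hx : x ∈ lCone n) : t • x ∈ lCone n :=
  ⟨by rw [lDelta_smul]; have := hx.1; positivity, by simpa using mul_pos ht hx.2⟩

/-- The Lorentz transformation that fixes `w` and is `-1` on the orthogonal complement of `w`. -/
def lorentzReflection {n : ℕ} [NeZero n] (w : Fin n → ℝ) : (Fin n → ℝ) →ₗ[ℝ] (Fin n → ℝ) :=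
  (2 / lDelta n w) • (lorentzForm n w).smulRight w - LinearMap.id

theorem lorentzReflection_apply {n : ℕ} [NeZero n] (w z : Fin n → ℝ) :
    lorentzReflection w z = (2 / lDelta n w * lorentzForm n w z) • w - z := by
  simp [lorentzReflection, smul_smul]

theorem lorentzForm_lorentzReflection {n : ℕ} [NeZero n] {w : Fin n → ℝ} (hw : lDelta n w ≠ 0)
    (z z' : Fin n → ℝ) :
    lorentzForm n (lorentzReflection w z) (lorentzReflection w z') = lorentzForm n z z' := by
  simp only [lorentzReflection_apply, map_sub, map_smul, LinearMap.sub_apply, LinearMap.smul_apply,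
    smul_eq_mul, lorentzForm_self, lorentzForm_comm z w]
  field_simp
  ring

theorem lorentzReflection_involutive {n : ℕ} [NeZero n] {w : Fin n → ℝ} (hw : lDelta n w ≠ 0)
    (z : Fin n → ℝ) : lorentzReflection w (lorentzReflection w z) = z := by
  have h : lorentzForm n w (lorentzReflection w z) = lorentzForm n w z := by
    simp only [lorentzReflection_apply, map_sub, map_smul, smul_eq_mul, lorentzForm_self]
    field_simp
    ring
  rw [lorentzReflection_apply, h, lorentzReflection_apply]
  abel

theorem abs_det_lorentzReflection {n : ℕ} [NeZero n] {w : Fin n → ℝ} (hw : lDelta n w ≠ 0) :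
    |LinearMap.det (lorentzReflection w)| = 1 := by
  have h : lorentzReflection w * lorentzReflection w = 1 :=
    LinearMap.ext fun z ↦ lorentzReflection_involutive hw z
  have h' := congrArg LinearMap.det h
  rw [map_mul, map_one] at h'
  rcases mul_self_eq_one_iff.1 h' with h | h <;> simp [h]

/-- The group of the Lorentz cone acts transitively. -/
theorem exists_linearMap_single_eq {n : ℕ} [NeZero n] {x : Fin n → ℝ} (hx : x ∈ lCone n) :
    ∃ L : (Fin n → ℝ) →ₗ[ℝ] (Fin n → ℝ), L (Pi.single 0 1) = x ∧
      |LinearMap.det L| = lDelta n x ^ ((n : ℝ) / 2) ∧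
      (∀ z, lDelta n (L z) = lDelta n x * lDelta n z) ∧ ∀ z, L z ∈ lCone n ↔ z ∈ lCone n := by
  set e : Fin n → ℝ := Pi.single 0 1 with he
  set t : ℝ := √(lDelta n x)
  have ht : 0 < t := Real.sqrt_pos.2 hx.1
  have ht2 : t ^ 2 = lDelta n x := Real.sq_sqrt hx.1.le
  set v : Fin n → ℝ := t⁻¹ • x with hv
  have hvC : v ∈ lCone n := smul_mem_lCone (inv_pos.2 ht) hx
  have heC : e ∈ lCone n := single_mem_lCone n
  have hΔv : lDelta n v = 1 := by
    rw [lDelta_smul, ← ht2]; field_simp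
  have hΔe : lDelta n e = 1 := by rw [← lorentzForm_self, lorentzForm_single]; simp [he]
  have hw : 0 < lDelta n (e + v) := lDelta_add_pos heC hvC
  have hRe : lorentzReflection (e + v) e = v := by
    have h1 : lDelta n (e + v) = 2 * lorentzForm n (e + v) e := by
      rw [← lorentzForm_self]
      simp only [map_add, LinearMap.add_apply, lorentzForm_self, hΔv, hΔe, lorentzForm_comm v e]
      ring
    rw [lorentzReflection_apply, div_mul_eq_mul_div, ← h1, div_self hw.ne', one_smul,
      add_sub_cancel_left]
  have hRC (z) (hz : z ∈ lCone n) : lorentzReflection (e + v) z ∈ lCone n := by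
    constructor
    · rw [← lorentzForm_self, lorentzForm_lorentzReflection hw.ne', lorentzForm_self]
      exact hz.1
    · have hRv : lorentzReflection (e + v) v = e :=
        (congrArg _ hRe.symm).trans (lorentzReflection_involutive hw.ne' e)
      have h := lorentzForm_lorentzReflection hw.ne' z v
      rw [hRv] at h
      rw [← lorentzForm_single (lorentzReflection _ z)]
      exact (lorentzForm_pos hz hvC).trans_eq h.symm
  refine ⟨t • lorentzReflection (e + v), ?_, ?_, fun z ↦ ?_, fun z ↦ ⟨fun h ↦ ?_, fun h ↦ ?_⟩⟩
  · rw [LinearMap.smul_apply, hRe, hv, smul_inv_smul₀ ht.ne']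
  · rw [LinearMap.det_smul, abs_mul, abs_det_lorentzReflection hw.ne', mul_one,
      abs_of_pos (by positivity), Module.finrank_fin_fun, ← ht2, ← Real.rpow_natCast t 2,
      ← Real.rpow_mul ht.le, ← Real.rpow_natCast]
    congr 1
    push_cast
    ring
  · rw [LinearMap.smul_apply, lDelta_smul, ht2, ← lorentzForm_self (lorentzReflection _ _),
      lorentzForm_lorentzReflection hw.ne', lorentzForm_self]
  · have := hRC _ (smul_mem_lCone (inv_pos.2 ht) h)
    rwa [LinearMap.smul_apply, inv_smul_smul₀ ht.ne', lorentzReflection_involutive hw.ne'] at this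
  · exact smul_mem_lCone ht (hRC z h)

theorem lintegral_lCone_eq {n : ℕ} [NeZero n] {x : Fin n → ℝ} (hx : x ∈ lCone n) (c s : ℝ) :
    ∫⁻ y in lCone n, ENNReal.ofReal (lDelta n y ^ c * lDelta n (y + x) ^ (-s)) =
      ENNReal.ofReal (lDelta n x ^ (c - s + (n : ℝ) / 2)) *
        ∫⁻ y in lCone n, ENNReal.ofReal
          (lDelta n y ^ c * lDelta n (y + Pi.single 0 1) ^ (-s)) := by
  obtain ⟨L, hLe, hdet, hΔ, hC⟩ := exists_linearMap_single_eq hx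
  have hm := measurable_lDelta n
  have hΔx : 0 < lDelta n x := hx.1
  have hpos : 0 < |LinearMap.det L| := by rw [hdet]; exact Real.rpow_pos_of_pos hΔx _
  set F : (Fin n → ℝ) → ℝ≥0∞ := (lCone n).indicator fun y ↦
    ENNReal.ofReal (lDelta n y ^ c * lDelta n (y + x) ^ (-s)) with hF
  have hFm : Measurable F := Measurable.indicator (by fun_prop) (measurableSet_lCone n)
  have h1 : ∫⁻ z, F (L z) = ENNReal.ofReal |LinearMap.det L|⁻¹ * ∫⁻ y, F y := by
    rw [← lintegral_map hFm L.continuous_of_finiteDimensional.measurable,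
      Measure.map_linearMap_addHaar_eq_smul_addHaar _ (abs_pos.1 hpos), lintegral_smul_measure,
      abs_inv, smul_eq_mul]
  have h2 : ∫⁻ y, F y = ENNReal.ofReal |LinearMap.det L| * ∫⁻ z, F (L z) := by
    rw [h1, ← mul_assoc, ← ENNReal.ofReal_mul hpos.le, mul_inv_cancel₀ hpos.ne',
      ENNReal.ofReal_one, one_mul]
  have h3 : ∫⁻ z, F (L z) = ENNReal.ofReal (lDelta n x ^ (c - s)) *
      ∫⁻ y in lCone n, ENNReal.ofReal
          (lDelta n y ^ c * lDelta n (y + Pi.single 0 1) ^ (-s)) := by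
    rw [← lintegral_const_mul _ (by fun_prop), ← lintegral_indicator (measurableSet_lCone n)]
    refine lintegral_congr fun z ↦ ?_
    by_cases hz : z ∈ lCone n
    · rw [hF, Set.indicator_of_mem ((hC z).2 hz), Set.indicator_of_mem hz,
        ← ENNReal.ofReal_mul (by positivity)]
      congr 1
      have hadd : L z + x = L (z + Pi.single 0 1) := by rw [map_add, hLe]
      rw [hadd, hΔ, hΔ, Real.mul_rpow hΔx.le hz.1.le,
        Real.mul_rpow hΔx.le (lDelta_add_pos hz (single_mem_lCone n)).le, sub_eq_add_neg,
        Real.rpow_add hΔx]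
      ring
    · rw [hF, Set.indicator_of_notMem (fun h ↦ hz ((hC z).1 h)), Set.indicator_of_notMem hz]
  rw [← lintegral_indicator (measurableSet_lCone n), h2, h3, hdet, ← mul_assoc,
    ← ENNReal.ofReal_mul (by positivity), ← Real.rpow_add hΔx, add_comm]

theorem lintegral_rpow_le_lintegral_rpow_mul {X : Type*} [MeasurableSpace X] (m : Measure X)
    {q : ℝ} (hq : 1 < q) {k : X → ℝ≥0∞} (hk : AEMeasurable k m) :
    (∫⁻ x, k x ∂m) ^ q ≤ (∫⁻ x, k x ^ q ∂m) * m Set.univ ^ (q - 1) := by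
  have hq0 : 0 < q := by linarith
  have h := ENNReal.lintegral_mul_le_Lp_mul_Lq m (Real.HolderConjugate.conjExponent hq) hk
    (aemeasurable_const (b := (1 : ℝ≥0∞)))
  simp only [Pi.mul_apply, mul_one, ENNReal.one_rpow, lintegral_one] at h
  calc (∫⁻ x, k x ∂m) ^ q
      ≤ ((∫⁻ x, k x ^ q ∂m) ^ (1 / q) * m Set.univ ^ (1 / q.conjExponent)) ^ q :=
        ENNReal.rpow_le_rpow h hq0.le
    _ = _ := by
      rw [ENNReal.mul_rpow_of_nonneg _ _ hq0.le, ← ENNReal.rpow_mul, ← ENNReal.rpow_mul,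
        one_div_mul_cancel hq0.ne', ENNReal.rpow_one]
      congr 2
      rw [Real.conjExponent]
      field_simp

/-- Lemma 4.2 of the paper on the rank-2 Lorentz cone (sufficiency, `p = 1`). -/
theorem statement11 (n : ℕ) [NeZero n] (hn : 3 ≤ n) (α β γ ν μ q : ℝ)
    (hq : 1 < q) (hμ : 0 < μ)
    (h1 : γ = α + β + (n : ℝ) / 2 - ν + μ / q)
    (h2 : 0 < γ)
    (h3 : (n : ℝ) / 2 - 1 - q * α < μ)
    (h4 : μ < q * (γ - α) - (n : ℝ) / 2 + 1) :
    SBounded n α β γ 1 ν q μ := by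
  have hq0 : 0 < q := by linarith
  have hm := measurable_lDelta n
  have hCm := measurableSet_lCone n
  set c : ℝ := q * α + μ - (n : ℝ) / 2 with hc
  set s : ℝ := γ * q with hs
  set δ : ℝ := β - ν + (n : ℝ) / 2 with hδ
  set I : ℝ≥0∞ := ∫⁻ y in lCone n, ENNReal.ofReal
      (lDelta n y ^ c * lDelta n (y + Pi.single 0 1) ^ (-s))
  have hI : I < ⊤ := by
    obtain ⟨m, rfl⟩ : ∃ m, n = m + 1 := Nat.exists_eq_succ_of_ne_zero (NeZero.ne n)
    refine lintegral_lCone_vertex_lt_top (by omega) (by linarith) ?_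
    push_cast at *
    linarith
  have hexp : c - s + (n : ℝ) / 2 + δ * q = 0 := by
    rw [hc, hs, hδ, h1]; field_simp; ring
  refine ⟨(I ^ (1 / q)).toReal + 1, by positivity, fun g hg _ ↦ ?_⟩
  set W : (Fin n → ℝ) → ℝ≥0∞ :=
    fun x ↦ ENNReal.ofReal (|g x| ^ (1 : ℝ) * lDelta n x ^ (ν - (n : ℝ) / 2)) with hW
  have hWm : Measurable W := by fun_prop
  set M : ℝ≥0∞ := ∫⁻ x in lCone n, W x
  set m : Measure (Fin n → ℝ) := (volume.restrict (lCone n)).withDensity W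
  have hmuniv : m Set.univ = M := by rw [withDensity_apply _ .univ, Measure.restrict_univ]
  set k : (Fin n → ℝ) → (Fin n → ℝ) → ℝ≥0∞ :=
    fun y x ↦ ENNReal.ofReal (lDelta n (y + x) ^ (-γ) * lDelta n x ^ δ) with hk
  have hkm (y) : Measurable (k y) := by fun_prop
  have hS (y) (hy : y ∈ lCone n) :
      Sop n α β γ g y = ENNReal.ofReal (lDelta n y ^ α) * ∫⁻ x, k y x ∂m := by
    rw [Sop, lintegral_withDensity_eq_lintegral_mul _ hWm (hkm y)]
    congr 1
    refine setLIntegral_congr_fun hCm fun x hx ↦ ?_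
    have hΔx : 0 < lDelta n x := hx.1
    rw [Pi.mul_apply, hW, hk, ← ENNReal.ofReal_mul (by positivity)]
    congr 1
    have : β = (ν - (n : ℝ) / 2) + δ := by rw [hδ]; ring
    rw [this, Real.rpow_add hΔx, Real.rpow_one]
    ring
  have hkey : ∫⁻ y in lCone n, Sop n α β γ g y ^ q *
      ENNReal.ofReal (lDelta n y ^ (μ - (n : ℝ) / 2)) ≤ M ^ q * I := by
    calc ∫⁻ y in lCone n, Sop n α β γ g y ^ q * ENNReal.ofReal (lDelta n y ^ (μ - (n : ℝ) / 2))
        ≤ ∫⁻ y in lCone n, M ^ (q - 1) *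
            ∫⁻ x in lCone n, W x * (ENNReal.ofReal (lDelta n y ^ c) * k y x ^ q) := by
          refine setLIntegral_mono' hCm fun y hy ↦ ?_
          have hΔy : 0 < lDelta n y := hy.1
          have e : ENNReal.ofReal (lDelta n y ^ α) ^ q *
              ENNReal.ofReal (lDelta n y ^ (μ - (n : ℝ) / 2)) =
              ENNReal.ofReal (lDelta n y ^ c) := by
            rw [ENNReal.ofReal_rpow_of_nonneg (by positivity) hq0.le,
              ← ENNReal.ofReal_mul (by positivity), ← Real.rpow_mul hΔy.le, ← Real.rpow_add hΔy]
            congr 2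
            rw [hc]; ring
          have hj := lintegral_rpow_le_lintegral_rpow_mul m hq (hkm y).aemeasurable
          rw [hmuniv] at hj
          rw [hS y hy, ENNReal.mul_rpow_of_nonneg _ _ hq0.le, mul_right_comm, e]
          refine (mul_le_mul_right hj _).trans_eq ?_
          rw [lintegral_withDensity_eq_lintegral_mul _ hWm (by fun_prop), ← mul_assoc,
            mul_comm _ (M ^ (q - 1)), ← lintegral_const_mul _ (by fun_prop)]
          congr 1
          refine lintegral_congr fun x ↦ ?_
          rw [Pi.mul_apply]; ring
      _ = M ^ (q - 1) * ∫⁻ x in lCone n, W x *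
            ∫⁻ y in lCone n, ENNReal.ofReal (lDelta n y ^ c) * k y x ^ q := by
          rw [lintegral_const_mul]
          · rw [lintegral_lintegral_swap (by fun_prop)]
            congr 1
            refine lintegral_congr fun x ↦ ?_
            rw [lintegral_const_mul _ (by fun_prop)]
          · refine Measurable.lintegral_prod_right' (f := fun p : (Fin n → ℝ) × (Fin n → ℝ) ↦
              W p.2 * (ENNReal.ofReal (lDelta n p.1 ^ c) * k p.1 p.2 ^ q)) (by fun_prop)
      _ = M ^ (q - 1) * ∫⁻ x in lCone n, W x * I := by
          congr 1
          refine setLIntegral_congr_fun hCm fun x hx ↦ ?_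
          have hΔx : 0 < lDelta n x := hx.1
          congr 1
          have : ∀ y ∈ lCone n, ENNReal.ofReal (lDelta n y ^ c) * k y x ^ q =
              ENNReal.ofReal (lDelta n x ^ (δ * q)) *
                ENNReal.ofReal (lDelta n y ^ c * lDelta n (y + x) ^ (-s)) := by
            intro y hy
            have hΔy : 0 < lDelta n y := hy.1
            have hΔ := lDelta_add_pos hy hx
            rw [hk, ENNReal.ofReal_rpow_of_nonneg (by positivity) hq0.le,
              ← ENNReal.ofReal_mul (by positivity), ← ENNReal.ofReal_mul (by positivity),
              Real.mul_rpow (by positivity) (by positivity), ← Real.rpow_mul hΔx.le,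
              ← Real.rpow_mul hΔ.le, neg_mul]
            congr 1
            ring
          rw [setLIntegral_congr_fun hCm this, lintegral_const_mul _ (by fun_prop),
            lintegral_lCone_eq hx, ← mul_assoc, ← ENNReal.ofReal_mul (by positivity),
            ← Real.rpow_add hΔx, add_comm, hexp, Real.rpow_zero, ENNReal.ofReal_one, one_mul]
      _ = M ^ q * I := by
          rw [lintegral_mul_const _ hWm, ← mul_assoc]
          congr 1
          have h := ENNReal.rpow_add_of_nonneg (x := M) (q - 1) 1 (by linarith) zero_le_one
          rw [sub_add_cancel, ENNReal.rpow_one] at h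
          exact h.symm
  have hcone : coneNorm n 1 ν g = M := by rw [coneNorm, div_one, ENNReal.rpow_one]
  rw [hcone, SopNorm]
  calc _ ≤ (M ^ q * I) ^ (1 / q) := ENNReal.rpow_le_rpow hkey (by positivity)
    _ = I ^ (1 / q) * M := by
        rw [ENNReal.mul_rpow_of_nonneg _ _ (by positivity), ← ENNReal.rpow_mul,
          mul_one_div_cancel hq0.ne', ENNReal.rpow_one, mul_comm]
    _ ≤ _ := by
        gcongr
        rw [ENNReal.le_ofReal_iff_toReal_le
          (ENNReal.rpow_ne_top_of_nonneg (by positivity) hI.ne) (by positivity)]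
        linarith
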